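/- Let T be a triangulation of the completed ∞-gon and let θ be a T-admissible sequence. If (m,l) ∈ μ_θ(T) is a peripheral arc (m, l ∈ ℤ), then μ_θ(T)|_{[m,l]} = {(a,b) ∈ μ_θ(T) : m ≤ a < b ≤ l} is a maximal set of pairwise compatible arcs with both endpoints in {m, m+1, …, l}, i.e. a triangulation of the finite polygon with vertices m, m+1, …, l. -/

import Mathlib

open scoped Classical

/-- Vertices of the completed ∞-gon: `ℤ ∪ {−∞, +∞}` with the extended linear order. -/
abbrev Vtx : Type := WithBot (WithTop ℤ)

/-- The vertex corresponding to an integer. -/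
def vInt (m : ℤ) : Vtx := ((m : WithTop ℤ) : Vtx)

/-- The vertex `+∞`. -/
def vTop : Vtx := ((⊤ : WithTop ℤ) : Vtx)

/-- The vertex `−∞`. -/
def vBot : Vtx := (⊥ : Vtx)

/-- An arc of the completed ∞-gon: a pair of vertices `src < tgt` such that if both
endpoints are integers then they differ by at least `2`. -/
structure Arc where
  src : Vtx
  tgt : Vtx
  lt : src < tgt
  sep : ∀ m n : ℤ, src = vInt m → tgt = vInt n → m + 2 ≤ n

/-- Two arcs `(a,b)` and `(c,d)` cross if `a < c < b < d` or `c < a < d < b`. -/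
def Cross (x y : Arc) : Prop :=
  (x.src < y.src ∧ y.src < x.tgt ∧ x.tgt < y.tgt) ∨
  (y.src < x.src ∧ x.src < y.tgt ∧ y.tgt < x.tgt)

/-- A triangulation of the completed ∞-gon: a maximal set of pairwise compatible
(= non-crossing) arcs. -/
def IsTriangulation (T : Set Arc) : Prop :=
  (∀ x ∈ T, ∀ y ∈ T, ¬ Cross x y) ∧
  ∀ γ : Arc, (∀ x ∈ T, ¬ Cross γ x) → γ ∈ T

lemma vInt_lt_vTop (m : ℤ) : vInt m < vTop := by
  simpa [vInt, vTop] using WithBot.coe_lt_coe.mpr (WithTop.coe_lt_top (m : ℤ))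

lemma vBot_lt_vInt (m : ℤ) : vBot < vInt m := WithBot.bot_lt_coe _

lemma vBot_lt_vTop : vBot < vTop := WithBot.bot_lt_coe _

lemma vTop_ne_vInt (n : ℤ) : vTop ≠ vInt n := by simp [vTop, vInt]

lemma vBot_ne_vInt (n : ℤ) : vBot ≠ vInt n := by simp [vBot, vInt]

/-- The Prüfer curve `π_m = (m, +∞)`. -/
def prufer (m : ℤ) : Arc :=
  ⟨vInt m, vTop, vInt_lt_vTop m, fun _ n _ h => absurd h (vTop_ne_vInt n)⟩

/-- The adic curve `α_m = (−∞, m)`. -/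
def adic (m : ℤ) : Arc :=
  ⟨vBot, vInt m, vBot_lt_vInt m, fun k _ h _ => absurd h (vBot_ne_vInt k)⟩

/-- The generic curve `z = (−∞, +∞)`. -/
def generic : Arc :=
  ⟨vBot, vTop, vBot_lt_vTop, fun k _ h _ => absurd h (vBot_ne_vInt k)⟩

/-- `T` contains an arc with endpoints `x` and `y`. -/
def HasArc (T : Set Arc) (x y : Vtx) : Prop := ∃ γ ∈ T, γ.src = x ∧ γ.tgt = y

/-- `T` has a right fountain at the integer `n`. -/
def RightFountainInt (T : Set Arc) (n : ℤ) : Prop :=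
  {p : ℤ | HasArc T (vInt n) (vInt p)}.Infinite

/-- `T` has a left fountain at the integer `n`. -/
def LeftFountainInt (T : Set Arc) (n : ℤ) : Prop :=
  {p : ℤ | HasArc T (vInt p) (vInt n)}.Infinite

/-- `T` has a right fountain at the vertex `v`. -/
def RightFountain (T : Set Arc) (v : Vtx) : Prop :=
  (∃ n : ℤ, v = vInt n ∧ RightFountainInt T n) ∨
  (v = vTop ∧ {p : ℤ | 0 ≤ p ∧ prufer p ∈ T}.Infinite) ∨
  (v = vBot ∧ {p : ℤ | 0 ≤ p ∧ adic p ∈ T}.Infinite)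

/-- `T` has a left fountain at the vertex `v`. -/
def LeftFountain (T : Set Arc) (v : Vtx) : Prop :=
  (∃ n : ℤ, v = vInt n ∧ LeftFountainInt T n) ∨
  (v = vTop ∧ {p : ℤ | p ≤ 0 ∧ prufer p ∈ T}.Infinite) ∨
  (v = vBot ∧ {p : ℤ | p ≤ 0 ∧ adic p ∈ T}.Infinite)

/-- `T` is locally finite if every vertex is an endpoint of only finitely many arcs of `T`. -/
def LocallyFin (T : Set Arc) : Prop :=
  ∀ v : Vtx, {γ | γ ∈ T ∧ (γ.src = v ∨ γ.tgt = v)}.Finite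

/-- An arc is peripheral if both endpoints are integers. -/
def IsPeripheral (γ : Arc) : Prop :=
  (∃ m : ℤ, γ.src = vInt m) ∧ ∃ n : ℤ, γ.tgt = vInt n

/-- `γ'` is an exchange partner for `γ` relative to `T`:
it is distinct from `γ` and `(T \ {γ}) ∪ {γ'}` is again a triangulation. -/
def MutExchange (T : Set Arc) (γ γ' : Arc) : Prop :=
  γ' ≠ γ ∧ IsTriangulation ((T \ {γ}) ∪ {γ'})

/-- `γ` is a mutable arc of `T`. -/
def IsMutable (T : Set Arc) (γ : Arc) : Prop :=
  γ ∈ T ∧ ∃ γ', MutExchange T γ γ'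

/-- The (unique) replacement arc of `γ` in `T`, when `γ` is mutable. -/
noncomputable def flipArc (T : Set Arc) (γ : Arc) : Arc :=
  if h : ∃ γ', MutExchange T γ γ' then h.choose else γ

/-- The mutation `μ_γ(T)` of `T` at `γ`. -/
noncomputable def mutate (T : Set Arc) (γ : Arc) : Set Arc :=
  (T \ {γ}) ∪ {flipArc T γ}

/-- `μ_γ(δ)`: the effect of the mutation of `T` at `γ` on the arc `δ`. -/
noncomputable def mutArc (T : Set Arc) (γ δ : Arc) : Arc :=
  if δ = γ then flipArc T γ else δ

/-- One step of a mutation sequence on a set of arcs (`none` = no entry). -/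
noncomputable def stepT (T : Set Arc) : Option Arc → Set Arc
  | none => T
  | some γ => mutate T γ

/-- One step of a mutation sequence on a single arc. -/
noncomputable def stepA (T : Set Arc) : Option Arc → Arc → Arc
  | none, δ => δ
  | some γ, δ => mutArc T γ δ

/-- `iterT T θ k` is `μ_{θ_k} ∘ ⋯ ∘ μ_{θ_1}(T)`. Sequences (finite or infinite) are
encoded as `θ : ℕ → Option Arc` whose support is downward closed. -/
noncomputable def iterT (T : Set Arc) (θ : ℕ → Option Arc) : ℕ → Set Arc
  | 0 => T
  | k + 1 => stepT (iterT T θ k) (θ k)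

/-- `iterA T θ γ k` is `μ_{θ_k} ∘ ⋯ ∘ μ_{θ_1}(γ)`. -/
noncomputable def iterA (T : Set Arc) (θ : ℕ → Option Arc) (γ : Arc) : ℕ → Arc
  | 0 => γ
  | k + 1 => stepA (iterT T θ k) (θ k) (iterA T θ γ k)

/-- `θ` is a `T`-admissible sequence: its support is downward closed (so it is a genuine
finite or infinite sequence), each entry is mutable in the triangulation obtained by the
previous mutations, and the mutation of each arc of `T` along `θ` eventually stabilizes. -/
def Admissible (T : Set Arc) (θ : ℕ → Option Arc) : Prop :=
  (∀ i, θ i = none → θ (i + 1) = none) ∧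
  (∀ i γ, θ i = some γ → IsMutable (iterT T θ i) γ) ∧
  (∀ γ ∈ T, ∃ l, ∀ k, l ≤ k → iterA T θ γ k = iterA T θ γ l)

/-- `μ_θ(γ)`: the stable value of the mutation of the arc `γ` along the sequence `θ`. -/
noncomputable def seqLimit (T : Set Arc) (θ : ℕ → Option Arc) (γ : Arc) : Arc :=
  if h : ∃ l, ∀ k, l ≤ k → iterA T θ γ k = iterA T θ γ l
  then iterA T θ γ h.choose else γ

/-- `μ_θ(T)`: the mutation of `T` along the sequence `θ`. -/
noncomputable def mutSeq (T : Set Arc) (θ : ℕ → Option Arc) : Set Arc :=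
  seqLimit T θ '' T

/-- The sequence `θ` leaves the arc `γ` untouched. -/
def Untouched (T : Set Arc) (θ : ℕ → Option Arc) (γ : Arc) : Prop :=
  ∀ l, iterA T θ γ l = γ

/-- The quadrilateral `S(γ)` of a mutable arc `γ` in `T`: with `v₁ < v₂ < v₃ < v₄` the four
endpoints of the two diagonals `γ` and `flipArc T γ`, it consists of those of the pairs
`(v₁,v₂), (v₂,v₃), (v₃,v₄), (v₁,v₄)` that are arcs. -/
noncomputable def quad (T : Set Arc) (γ : Arc) : Set Arc :=
  let γ' := flipArc T γ
  let vs : Vtx × Vtx × Vtx × Vtx :=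
    if γ.src < γ'.src then (γ.src, γ'.src, γ.tgt, γ'.tgt) else (γ'.src, γ.src, γ'.tgt, γ.tgt)
  {δ : Arc | (δ.src = vs.1 ∧ δ.tgt = vs.2.1) ∨ (δ.src = vs.2.1 ∧ δ.tgt = vs.2.2.1) ∨
    (δ.src = vs.2.2.1 ∧ δ.tgt = vs.2.2.2) ∨ (δ.src = vs.1 ∧ δ.tgt = vs.2.2.2)}

/-- The set `𝒫` of Prüfer curves compatible with every arc of `S`. -/
def pruferCompletion (S : Set Arc) : Set Arc :=
  {γ | (∃ k : ℤ, γ = prufer k) ∧ ∀ x ∈ S, ¬ Cross γ x}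

/-- The set `𝒜̃` of adic curves compatible with every arc of `S ∪ 𝒫(S)`. -/
def adicCompletion' (S : Set Arc) : Set Arc :=
  {γ | (∃ k : ℤ, γ = adic k) ∧ ∀ x ∈ S ∪ pruferCompletion S, ¬ Cross γ x}

/-- The completed (Prüfer) mutation `μ̄_θ(T) = μ_θ(T) ∪ 𝒫 ∪ 𝒜̃` of `T` along `θ`. -/
noncomputable def completedMut (T : Set Arc) (θ : ℕ → Option Arc) : Set Arc :=
  mutSeq T θ ∪ pruferCompletion (mutSeq T θ) ∪ adicCompletion' (mutSeq T θ)

/-- The tower of triangulations associated to a composition of completed mutations. -/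
noncomputable def compIter (T : Set Arc) (Θ : ℕ → Option (ℕ → Option Arc)) : ℕ → Set Arc
  | 0 => T
  | k + 1 =>
    match Θ k with
    | none => compIter T Θ k
    | some θ => completedMut (compIter T Θ k) θ

/-- `Θ` is a `T`-admissible composition of completed mutations. -/
def CompAdmissible (T : Set Arc) (Θ : ℕ → Option (ℕ → Option Arc)) : Prop :=
  (∀ i, Θ i = none → Θ (i + 1) = none) ∧
  ∀ i θ, Θ i = some θ → Admissible (compIter T Θ i) θ

/-- The transfinite mutation of `T` along the composition `Θ`. -/
noncomputable def transfiniteMut (T : Set Arc) (Θ : ℕ → Option (ℕ → Option Arc)) : Set Arc :=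
  ⋃ i, {γ ∈ compIter T Θ i |
    ∀ k, i ≤ k → ∀ θ, Θ k = some θ → Untouched (compIter T Θ k) θ γ}

/-- `δ` is an arc with both endpoints integers in the interval `[m,l]`. -/
def WithinV (m l : ℤ) (δ : Arc) : Prop :=
  ∃ a b : ℤ, δ.src = vInt a ∧ δ.tgt = vInt b ∧ m ≤ a ∧ b ≤ l

/-- The restriction `S|_{[m,l]}` of a set of arcs to arcs with endpoints in `[m,l]`. -/
def restrictV (S : Set Arc) (m l : ℤ) : Set Arc := {δ ∈ S | WithinV m l δ}

lemma aux_vInt_le (a b : ℤ) : vInt a ≤ vInt b ↔ a ≤ b := by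
  simp [vInt]

lemma aux_between (m l : ℤ) (v : Vtx) (h1 : vInt m ≤ v) (h2 : v ≤ vInt l) :
    ∃ c : ℤ, v = vInt c := by
  induction v using WithBot.recBotCoe with
  | bot => simp [vInt] at h1
  | coe w =>
    induction w using WithTop.recTopCoe with
    | top => simp [vInt] at h2
    | coe c => exact ⟨c, rfl⟩

lemma aux_cross_symm {x y : Arc} (h : Cross x y) : Cross y x := by
  unfold Cross at *
  tauto

lemma aux_within_iff (m l : ℤ) (x : Arc) :
    WithinV m l x ↔ vInt m ≤ x.src ∧ x.tgt ≤ vInt l := by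
  constructor
  · rintro ⟨a, b, ha, hb, h1, h2⟩
    rw [ha, hb, aux_vInt_le, aux_vInt_le]
    exact ⟨h1, h2⟩
  · rintro ⟨h1, h2⟩
    obtain ⟨a, ha⟩ := aux_between m l x.src h1 (x.lt.le.trans h2)
    obtain ⟨b, hb⟩ := aux_between m l x.tgt (h1.trans x.lt.le) h2
    rw [ha, aux_vInt_le] at h1
    rw [hb, aux_vInt_le] at h2
    exact ⟨a, b, ha, hb, h1, h2⟩

lemma aux_within_of_cross {m l : ℤ} {γ δ x : Arc} (hm : γ.src = vInt m) (hl : γ.tgt = vInt l)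
    (hδ : WithinV m l δ) (hc : Cross δ x) (hn : ¬ Cross γ x) : WithinV m l x := by
  rw [aux_within_iff] at *
  rw [← hm, ← hl] at *
  obtain ⟨h1, h2⟩ := hδ
  unfold Cross at *
  rcases hc with ⟨c1, c2, c3⟩ | ⟨c1, c2, c3⟩
  · refine ⟨h1.trans c1.le, ?_⟩
    by_contra h
    push Not at h
    exact hn (Or.inl ⟨h1.trans_lt c1, c2.trans_le h2, h⟩)
  · refine ⟨?_, c3.le.trans h2⟩
    by_contra h
    push Not at h
    exact hn (Or.inr ⟨h, h1.trans_lt c2, c3.trans_le h2⟩)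

lemma aux_within_finite (m l : ℤ) : {x : Arc | WithinV m l x}.Finite := by
  have hf : (((Set.Icc m l) ×ˢ (Set.Icc m l)).image
      (fun p : ℤ × ℤ => ((vInt p.1, vInt p.2) : Vtx × Vtx))).Finite :=
    ((Set.finite_Icc m l).prod (Set.finite_Icc m l)).image _
  refine Set.Finite.of_finite_image (f := fun x : Arc => (x.src, x.tgt)) (hf.subset ?_) ?_
  · rintro _ ⟨x, ⟨a, b, ha, hb, h1, h2⟩, rfl⟩
    have := x.sep a b ha hb
    refine ⟨(a, b), ⟨⟨h1, by simp; omega⟩, ⟨by simp; omega, h2⟩⟩, ?_⟩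
    simp [ha, hb]
  · rintro ⟨a, b, h1, h2⟩ _ ⟨c, d, h3, h4⟩ _ h
    simp only [Prod.mk.injEq] at h
    obtain ⟨rfl, rfl⟩ := h
    rfl

lemma aux_flip_spec {T : Set Arc} {g : Arc} (h : IsMutable T g) :
    MutExchange T g (flipArc T g) := by
  unfold flipArc
  rw [dif_pos h.2]
  exact h.2.choose_spec

lemma aux_flip_cross {T : Set Arc} (hT : IsTriangulation T) {g : Arc} (h : IsMutable T g) :
    Cross (flipArc T g) g := by
  obtain ⟨hne, htri⟩ := aux_flip_spec h
  by_contra hc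
  have : g ∈ (T \ {g}) ∪ {flipArc T g} := by
    apply htri.2
    rintro x (⟨hx, -⟩ | hx)
    · exact hT.1 g h.1 x hx
    · rw [Set.mem_singleton_iff] at hx
      rw [hx]
      exact fun hc' => hc (aux_cross_symm hc')
  rcases this with ⟨-, h2⟩ | h2
  · exact h2 rfl
  · exact hne (Set.mem_singleton_iff.mp h2).symm

lemma aux_tri {T : Set Arc} (hT : IsTriangulation T) {θ : ℕ → Option Arc}
    (hθ : Admissible T θ) (k : ℕ) : IsTriangulation (iterT T θ k) := by
  induction k with
  | zero => exact hT
  | succ k ih =>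
    simp only [iterT]
    cases hk : θ k with
    | none => exact ih
    | some g => exact (aux_flip_spec (hθ.2.1 k g hk)).2

lemma aux_image {T : Set Arc} (hT : IsTriangulation T) {θ : ℕ → Option Arc}
    (hθ : Admissible T θ) (k : ℕ) :
    (fun s => iterA T θ s k) '' T = iterT T θ k ∧ Set.InjOn (fun s => iterA T θ s k) T := by
  induction k with
  | zero => simp [iterA, iterT, Set.InjOn]
  | succ k ih =>
    obtain ⟨ih1, ih2⟩ := ih
    simp only [iterA, iterT]
    cases hk : θ k with
    | none => exact ⟨ih1, ih2⟩
    | some g =>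
      have hmut := hθ.2.1 k g hk
      have htri := aux_tri hT hθ k
      have hcr := aux_flip_cross htri hmut
      have hnot : flipArc (iterT T θ k) g ∉ iterT T θ k :=
        fun h => htri.1 _ h _ hmut.1 hcr
      have hmem : ∀ s ∈ T, iterA T θ s k ∈ iterT T θ k := by
        intro s hs
        rw [← ih1]
        exact ⟨s, hs, rfl⟩
      simp only [stepA, stepT, mutArc, mutate]
      constructor
      · ext x
        constructor
        · rintro ⟨s, hs, rfl⟩
          dsimp only
          split_ifs with h
          · exact Or.inr rfl
          · exact Or.inl ⟨hmem s hs, h⟩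
        · rintro (⟨hx, hxg⟩ | hx)
          · rw [← ih1] at hx
            obtain ⟨s, hs, rfl⟩ := hx
            exact ⟨s, hs, if_neg hxg⟩
          · have hg := hmut.1
            rw [← ih1] at hg
            obtain ⟨s, hs, hsg⟩ := hg
            exact ⟨s, hs, (if_pos hsg).trans (Set.mem_singleton_iff.mp hx).symm⟩
      · intro s hs t ht hst
        dsimp only at hst
        split_ifs at hst with h1 h2 h2
        · exact ih2 hs ht (h1.trans h2.symm)
        · exact absurd (hst ▸ hmem t ht) hnot
        · exact absurd (hst ▸ hmem s hs) hnot
        · exact ih2 hs ht hst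

lemma aux_limit {T : Set Arc} {θ : ℕ → Option Arc}
    (hθ : Admissible T θ) {s : Arc} (hs : s ∈ T) :
    ∃ N, ∀ k, N ≤ k → iterA T θ s k = seqLimit T θ s := by
  have h := hθ.2.2 s hs
  refine ⟨h.choose, fun k hk => ?_⟩
  unfold seqLimit
  rw [dif_pos h]
  exact h.choose_spec k hk

lemma aux_mem_eventually {T : Set Arc} (hT : IsTriangulation T) {θ : ℕ → Option Arc}
    (hθ : Admissible T θ) {x : Arc} (hx : x ∈ mutSeq T θ) :
    ∃ N, ∀ k, N ≤ k → x ∈ iterT T θ k := by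
  obtain ⟨s, hs, rfl⟩ := hx
  obtain ⟨N, hN⟩ := aux_limit hθ hs
  refine ⟨N, fun k hk => ?_⟩
  rw [← hN k hk, ← (aux_image hT hθ k).1]
  exact ⟨s, hs, rfl⟩

lemma aux_within_step {T : Set Arc} (hT : IsTriangulation T) {θ : ℕ → Option Arc}
    (hθ : Admissible T θ) {m l : ℤ} {γ : Arc} (hm : γ.src = vInt m) (hl : γ.tgt = vInt l)
    (k : ℕ) (h0 : γ ∈ iterT T θ k) (h1 : γ ∈ iterT T θ (k + 1)) (s : Arc) :
    WithinV m l (iterA T θ s (k + 1)) ↔ WithinV m l (iterA T θ s k) := by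
  have htri' := aux_tri hT hθ (k + 1)
  simp only [iterA]
  simp only [iterT] at h1 htri'
  cases hk : θ k with
  | none => rfl
  | some g =>
    rw [hk] at h1 htri'
    have hmut := hθ.2.1 k g hk
    have htri := aux_tri hT hθ k
    have hcr := aux_flip_cross htri hmut
    simp only [stepA, mutArc]
    split_ifs with h
    · rw [h]
      constructor
      · intro hw
        exact aux_within_of_cross hm hl hw hcr (htri.1 _ h0 _ hmut.1)
      · intro hw
        exact aux_within_of_cross hm hl hw (aux_cross_symm hcr)
          (htri'.1 _ h1 _ (Or.inr rfl))
    · rfl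

/-- If `(m,l) ∈ μ_θ(T)` is a peripheral arc, then `μ_θ(T)|_{[m,l]}` is a triangulation of
the finite polygon with vertices `m, m+1, …, l`: a maximal set of pairwise compatible arcs
with both endpoints in `[m,l]`. -/
theorem statement16 (T : Set Arc) (hT : IsTriangulation T) (θ : ℕ → Option Arc)
    (hθ : Admissible T θ) (m l : ℤ) (γ : Arc) (hγ : γ ∈ mutSeq T θ)
    (hm : γ.src = vInt m) (hl : γ.tgt = vInt l) :
    (∀ x ∈ restrictV (mutSeq T θ) m l, ∀ y ∈ restrictV (mutSeq T θ) m l, ¬ Cross x y) ∧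
    ∀ δ : Arc, WithinV m l δ → (∀ x ∈ restrictV (mutSeq T θ) m l, ¬ Cross δ x) →
      δ ∈ restrictV (mutSeq T θ) m l := by
  obtain ⟨K, hK⟩ := aux_mem_eventually hT hθ hγ
  constructor
  · rintro x ⟨hx, -⟩ y ⟨hy, -⟩
    obtain ⟨N1, h1⟩ := aux_mem_eventually hT hθ hx
    obtain ⟨N2, h2⟩ := aux_mem_eventually hT hθ hy
    exact (aux_tri hT hθ (max N1 N2)).1 x (h1 _ (le_max_left _ _)) y (h2 _ (le_max_right _ _))
  · have hw : ∀ k, K ≤ k → ∀ s, WithinV m l (iterA T θ s k) ↔ WithinV m l (iterA T θ s K) := by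
      intro k hk
      induction k, hk using Nat.le_induction with
      | base => exact fun s => Iff.rfl
      | succ k hk ih =>
        intro s
        rw [aux_within_step hT hθ hm hl k (hK k hk) (hK (k + 1) (by omega)) s, ih s]
    have hfin : {s ∈ T | WithinV m l (iterA T θ s K)}.Finite := by
      refine Set.Finite.of_finite_image (f := fun s => iterA T θ s K)
        ((aux_within_finite m l).subset ?_) ((aux_image hT hθ K).2.mono fun s hs => hs.1)
      rintro _ ⟨s, hs, rfl⟩
      exact hs.2
    have hex : ∀ s : Arc, ∃ N, s ∈ T → ∀ k, N ≤ k → iterA T θ s k = seqLimit T θ s := by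
      intro s
      by_cases hs : s ∈ T
      · obtain ⟨N, hN⟩ := aux_limit hθ hs
        exact ⟨N, fun _ => hN⟩
      · exact ⟨0, fun h => absurd h hs⟩
    choose N hN using hex
    obtain ⟨B, hB⟩ := (hfin.image N).bddAbove
    have key : ∀ x ∈ iterT T θ (max K B), WithinV m l x → x ∈ restrictV (mutSeq T θ) m l := by
      intro x hx hxw
      refine ⟨?_, hxw⟩
      rw [← (aux_image hT hθ _).1] at hx
      obtain ⟨s, hs, rfl⟩ := hx
      have hsK := (hw _ (le_max_left K B) s).1 hxw
      have hle : N s ≤ B := hB ⟨s, ⟨hs, hsK⟩, rfl⟩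
      exact ⟨s, hs, (hN s hs _ (hle.trans (le_max_right _ _))).symm⟩
    intro δ hδ hcomp
    have htri := aux_tri hT hθ (max K B)
    refine key δ (htri.2 δ fun x hx hc => ?_) hδ
    have hxw := aux_within_of_cross hm hl hδ hc (htri.1 _ (hK _ (le_max_left _ _)) _ hx)
    exact hcomp x (key x hx hxw) hc
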